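/- arXiv:math/0605552 — 2 statements merged into one kernel-verified Lean document; each statement's English description precedes it below -/
import Mathlib

section
/- There is a universal constant C such that for every even n and every t > 0, |P(W_n ≤ t) − P(Z ≤ t)| ≤ C·max(1, t^{−3})/√n, where W_n takes the value W(i) := (n − 2i)(n + 2 − 2i)/(2n) with probability π(i), π(i) = (C(n,i) − C(n,i−1))/C(n, n/2) for 1 ≤ i ≤ n/2, π(0) = 1/C(n, n/2), and Z ~ Exp(1). -/
open Finset Filter

/-- The probability that the spectral measure puts on eigenvalue index `i`. -/
noncomputable def piBL (n i : ℕ) : ℝ :=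
  if i = 0 then 1 / (n.choose (n / 2) : ℝ)
  else ((n.choose i : ℝ) - (n.choose (i - 1) : ℝ)) / (n.choose (n / 2) : ℝ)

/-- The rescaled eigenvalue `W(i) = (n-2i)(n+2-2i)/(2n)`. -/
noncomputable def WBL (n i : ℕ) : ℝ :=
  ((n : ℝ) - 2 * i) * ((n : ℝ) + 2 - 2 * i) / (2 * n)

/-- `P(W_n ≤ t)` for the rescaled spectral measure of the Bernoulli-Laplace chain. -/
noncomputable def PBL (n : ℕ) (t : ℝ) : ℝ :=
  ∑ i ∈ Finset.range (n / 2 + 1), if WBL n i ≤ t then piBL n i else 0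


/-- The spectral measure telescopes: its partial sums are ratios of binomial coefficients. -/
lemma sum_range_piBL (n p : ℕ) :
    ∑ i ∈ Finset.range (p + 1), piBL n i = (n.choose p : ℝ) / (n.choose (n / 2) : ℝ) := by
  induction p with
  | zero => simp [piBL]
  | succ p ih =>
    rw [Finset.sum_range_succ, ih, piBL, if_neg (Nat.succ_ne_zero p), Nat.add_sub_cancel]
    ring

/-- The ratio of the binomial coefficient at distance `k` from the centre to the central one. -/
noncomputable def centralRatio (m k : ℕ) : ℝ :=
  ((2 * m).choose (m - k) : ℝ) / ((2 * m).choose m : ℝ)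

lemma centralRatio_zero (m : ℕ) : centralRatio m 0 = 1 := by
  have h : ((2 * m).choose m : ℝ) ≠ 0 := by
    exact_mod_cast (Nat.choose_pos (by omega)).ne'
  simp [centralRatio, h]

lemma centralRatio_succ {m k : ℕ} (hk : k < m) :
    centralRatio m (k + 1) = centralRatio m k * (((m : ℝ) - k) / (m + k + 1)) := by
  obtain ⟨p, rfl⟩ := Nat.exists_eq_add_of_lt hk
  have h := Nat.choose_succ_right_eq (2 * (k + p + 1)) p
  have e1 : k + p + 1 - (k + 1) = p := by omega
  have e2 : k + p + 1 - k = p + 1 := by omega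
  have e3 : 2 * (k + p + 1) - p = k + p + 1 + k + 1 := by omega
  rw [e3] at h
  have h' : ((2 * (k + p + 1)).choose (p + 1) : ℝ) * (p + 1)
      = ((2 * (k + p + 1)).choose p : ℝ) * (k + p + 1 + k + 1) := by exact_mod_cast h
  have hpos : (0 : ℝ) < (k : ℝ) + p + 1 + k + 1 := by positivity
  rw [centralRatio, centralRatio, e1, e2, div_mul_eq_mul_div]
  congr 1
  push_cast
  rw [mul_div_assoc', eq_div_iff hpos.ne', ← h']
  ring

lemma exp_neg_le_one_sub_add_sq {x : ℝ} (hx : 0 ≤ x) : Real.exp (-x) ≤ 1 - x + x ^ 2 := by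
  have h1 : Real.exp (-x) * Real.exp x = 1 := by rw [← Real.exp_add]; simp
  have h2 := Real.add_one_le_exp x
  have h3 := Real.exp_pos (-x)
  have h4 : Real.exp (-x) * (x + 1) ≤ 1 := by nlinarith
  have h5 : 0 ≤ x ^ 3 := by positivity
  by_contra! h
  nlinarith [mul_lt_mul_of_pos_right h (by linarith : (0 : ℝ) < x + 1)]

/-- One-step comparison of the ratio of consecutive binomial coefficients with its Gaussian
counterpart. -/
lemma abs_step_ratio_sub_exp_le {m k : ℝ} (hm : 0 < m) (hk : 0 ≤ k) :
    |(m - k) / (m + k + 1) - Real.exp (-((2 * k + 1) / m))| ≤ 4 * (k + 1) ^ 2 / m ^ 2 := by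
  set x := (2 * k + 1) / m with hx
  have hx0 : 0 ≤ x := by positivity
  have h1 := exp_neg_le_one_sub_add_sq hx0
  have h2 := Real.add_one_le_exp (-x)
  have hr : (m - k) / (m + k + 1) = 1 - x + (2 * k + 1) * (k + 1) / (m * (m + k + 1)) := by
    have : m + k + 1 ≠ 0 := by positivity
    rw [hx]
    field_simp
    ring
  have hr0 : 0 ≤ (2 * k + 1) * (k + 1) / (m * (m + k + 1)) := by positivity
  have hr1 : (2 * k + 1) * (k + 1) / (m * (m + k + 1)) ≤ 4 * (k + 1) ^ 2 / m ^ 2 := by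
    apply div_le_div₀ (by positivity) (by nlinarith) (by positivity)
    nlinarith
  have hx2 : x ^ 2 ≤ 4 * (k + 1) ^ 2 / m ^ 2 := by
    rw [hx, div_pow]
    gcongr
    nlinarith
  rw [hr, abs_le]
  constructor <;> linarith

/-- A Gaussian weight turns the one-step error into a telescoping one. -/
lemma exp_neg_sq_mul_le {s k : ℝ} (hs : 1 ≤ s) (hk : 0 ≤ k) :
    Real.exp (-(k ^ 2 / s ^ 2)) * (4 * (k + 1) ^ 2 / (s ^ 2) ^ 2)
      ≤ 128 * (1 / (s + k) - 1 / (s + (k + 1))) := by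
  have hs0 : 0 < s := by linarith
  have hE : Real.exp (-(k ^ 2 / s ^ 2)) ≤ 4 * (s ^ 2) ^ 2 / (2 * s ^ 2 + k ^ 2) ^ 2 := by
    have h1 := Real.add_one_le_exp (k ^ 2 / s ^ 2 / 2)
    have h2 : Real.exp (k ^ 2 / s ^ 2) = Real.exp (k ^ 2 / s ^ 2 / 2) ^ 2 := by
      rw [← Real.exp_nat_mul]
      congr 1
      push_cast
      ring
    have h3 : 4 * (s ^ 2) ^ 2 / (2 * s ^ 2 + k ^ 2) ^ 2 = ((k ^ 2 / s ^ 2 / 2 + 1) ^ 2)⁻¹ := by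
      field_simp
      ring
    rw [Real.exp_neg, h2, h3]
    gcongr
  have hsub : 1 / (s + k) - 1 / (s + (k + 1)) = 1 / ((s + k) * (s + (k + 1))) := by
    field_simp
    ring
  have hA : (s + k) * (s + (k + 1)) ≤ 4 * (s ^ 2 + k ^ 2) := by
    nlinarith [sq_nonneg (s - k)]
  have hB : (k + 1) ^ 2 ≤ 2 * (s ^ 2 + k ^ 2) := by nlinarith [sq_nonneg (k - 1)]
  have hAB : (k + 1) ^ 2 * ((s + k) * (s + (k + 1))) ≤ 8 * (2 * s ^ 2 + k ^ 2) ^ 2 := by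
    calc (k + 1) ^ 2 * ((s + k) * (s + (k + 1)))
        ≤ (2 * (s ^ 2 + k ^ 2)) * (4 * (s ^ 2 + k ^ 2)) := by gcongr
      _ = 8 * (s ^ 2 + k ^ 2) ^ 2 := by ring
      _ ≤ 8 * (2 * s ^ 2 + k ^ 2) ^ 2 := by gcongr; nlinarith
  calc Real.exp (-(k ^ 2 / s ^ 2)) * (4 * (k + 1) ^ 2 / (s ^ 2) ^ 2)
      ≤ 4 * (s ^ 2) ^ 2 / (2 * s ^ 2 + k ^ 2) ^ 2 * (4 * (k + 1) ^ 2 / (s ^ 2) ^ 2) := by gcongr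
    _ = 16 * (k + 1) ^ 2 / (2 * s ^ 2 + k ^ 2) ^ 2 := by
      field_simp
      ring
    _ ≤ 128 * (1 / (s + k) - 1 / (s + (k + 1))) := by
      rw [hsub, mul_one_div, div_le_div_iff₀ (by positivity) (by positivity)]
      nlinarith

/-- Local limit theorem for central binomial coefficients, with a uniform rate. -/
lemma abs_centralRatio_sub_exp_le {m : ℕ} {s : ℝ} (hs : 1 ≤ s) (hm : s ^ 2 = m) {j : ℕ}
    (hj : j ≤ m) :
    |centralRatio m j - Real.exp (-((j : ℝ) ^ 2 / s ^ 2))| ≤ 128 * (1 / s - 1 / (s + j)) := by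
  induction j with
  | zero => simp [centralRatio_zero]
  | succ k ih =>
    have hk : k < m := hj
    have hkm : (k : ℝ) < m := by exact_mod_cast hk
    have hm0 : (0 : ℝ) < m := by rw [← hm]; positivity
    specialize ih hk.le
    have hk0 : (0 : ℝ) ≤ k := Nat.cast_nonneg k
    have hstep := abs_step_ratio_sub_exp_le hm0 hk0
    have hgauss := exp_neg_sq_mul_le hs hk0
    have hr0 : 0 ≤ ((m : ℝ) - k) / (m + k + 1) := div_nonneg (by linarith) (by positivity)
    have hr1 : ((m : ℝ) - k) / (m + k + 1) ≤ 1 := by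
      rw [div_le_one (by positivity)]
      linarith
    have hexp : Real.exp (-(((k + 1 : ℕ) : ℝ) ^ 2 / s ^ 2))
        = Real.exp (-((k : ℝ) ^ 2 / s ^ 2)) * Real.exp (-((2 * k + 1) / (m : ℝ))) := by
      rw [← Real.exp_add, ← hm]
      congr 1
      push_cast
      ring
    rw [centralRatio_succ hk, hexp]
    rw [← hm] at hstep hr0 hr1 ⊢
    set r := (s ^ 2 - (k : ℝ)) / (s ^ 2 + k + 1)
    set E := Real.exp (-((k : ℝ) ^ 2 / s ^ 2))
    set e := Real.exp (-((2 * k + 1) / s ^ 2))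
    have hE : 0 < E := Real.exp_pos _
    calc |centralRatio m k * r - E * e|
        = |(centralRatio m k - E) * r + E * (r - e)| := by congr 1; ring
      _ ≤ |centralRatio m k - E| * r + E * |r - e| := by
        refine (abs_add_le _ _).trans_eq ?_
        rw [abs_mul, abs_mul, abs_of_nonneg hr0, abs_of_pos hE]
      _ ≤ |centralRatio m k - E| * 1 + E * (4 * ((k : ℝ) + 1) ^ 2 / (s ^ 2) ^ 2) := by
        gcongr
      _ ≤ 128 * (1 / s - 1 / (s + ((k + 1 : ℕ) : ℝ))) := by
        push_cast
        linarith

/-- Replacing `t` by the nearby `j ^ 2 / s ^ 2` costs at most `3 / s`. -/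
lemma abs_exp_sq_sub_exp_le {s j t : ℝ} (hs : 1 ≤ s) (hj : 0 ≤ j) (hjs : j ≤ s ^ 2)
    (hlo : (j - 1) * j ≤ s ^ 2 * t) (hhi : s ^ 2 * t ≤ j * (j + 1)) :
    |Real.exp (-(j ^ 2 / s ^ 2)) - Real.exp (-t)| ≤ 3 / s := by
  have hs0 : 0 < s := by linarith
  have hs2 : 0 < s ^ 2 := by positivity
  set a := j ^ 2 / s ^ 2 with ha
  set d := j / s ^ 2 with hd
  have hd0 : 0 ≤ d := by positivity
  have hd1 : d ≤ 1 := by rw [hd, div_le_one hs2]; exact hjs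
  have ht1 : a - d ≤ t := by
    rw [ha, hd, ← sub_div, div_le_iff₀ hs2]
    linarith
  have ht2 : t ≤ a + d := by
    rw [ha, hd, ← add_div, le_div_iff₀ hs2]
    linarith
  have hEa : Real.exp (-a) * (a + 1) ≤ 1 := by
    have h1 : Real.exp (-a) * Real.exp a = 1 := by rw [← Real.exp_add]; simp
    nlinarith [Real.add_one_le_exp a, Real.exp_pos (-a)]
  have hda : d ≤ (a + 1) / s := by
    rw [ha, hd, le_div_iff₀ hs0, ← sub_nonneg]
    have : j ^ 2 / s ^ 2 + 1 - j / s ^ 2 * s = ((j - s) ^ 2 + j * s) / s ^ 2 := by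
      field_simp
      ring
    rw [this]
    positivity
  have hEd : Real.exp (-a) * d ≤ 1 / s := by
    calc Real.exp (-a) * d ≤ Real.exp (-a) * ((a + 1) / s) := by gcongr
      _ = Real.exp (-a) * (a + 1) / s := by ring
      _ ≤ 1 / s := by gcongr
  have hup : Real.exp (-t) ≤ Real.exp (-a) * Real.exp d := by
    rw [← Real.exp_add]
    apply Real.exp_le_exp.2
    linarith
  have hdn : Real.exp (-a) * Real.exp (-d) ≤ Real.exp (-t) := by
    rw [← Real.exp_add]
    apply Real.exp_le_exp.2
    linarith
  have h1 : 1 - d ≤ Real.exp (-d) := by linarith [Real.add_one_le_exp (-d)]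
  have h2 : Real.exp d ≤ 1 + 3 * d := by
    have h3 : Real.exp d * Real.exp (-d) = 1 := by rw [← Real.exp_add]; simp
    have h4 : Real.exp d ≤ 3 :=
      (Real.exp_le_exp.2 hd1).trans (by linarith [Real.exp_one_lt_d9])
    nlinarith [Real.exp_pos d]
  have hE := Real.exp_pos (-a)
  have h5 : Real.exp (-a) * (1 - d) ≤ Real.exp (-t) :=
    (mul_le_mul_of_nonneg_left h1 hE.le).trans hdn
  have h6 : Real.exp (-t) ≤ Real.exp (-a) * (1 + 3 * d) :=
    hup.trans (mul_le_mul_of_nonneg_left h2 hE.le)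
  have h7 : 3 / s = 3 * (1 / s) := by ring
  have h8 : 0 ≤ 1 / s := by positivity
  rw [abs_le, h7]
  constructor <;> nlinarith

lemma WBL_two_mul {m i k : ℕ} (hm : 0 < m) (h : i + k = m) :
    WBL (2 * m) i = (k : ℝ) * (k + 1) / m := by
  have hm' : (m : ℝ) ≠ 0 := by exact_mod_cast hm.ne'
  have hi : (i : ℝ) = m - k := by rw [← h]; push_cast; ring
  rw [WBL, hi]
  push_cast
  field_simp
  ring

/-- If `j` is the first index with `m * t < j * (j + 1)`, the distribution function at `t` is the
complement of a single ratio of binomial coefficients. -/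
lemma PBL_two_mul {m j : ℕ} {t : ℝ} (hm : 0 < m)
    (hj : ∀ k : ℕ, (k : ℝ) * (k + 1) ≤ m * t ↔ k < j) :
    PBL (2 * m) t = 1 - if j ≤ m then centralRatio m j else 0 := by
  have hm' : (0 : ℝ) < m := by exact_mod_cast hm
  have hhalf : 2 * m / 2 = m := by omega
  have hsum : ∑ i ∈ Finset.range (m + 1), piBL (2 * m) i = 1 := by
    rw [sum_range_piBL, hhalf]
    exact div_self (by exact_mod_cast (Nat.choose_pos (by omega)).ne')
  have htail : ∑ i ∈ Finset.range (m + 1), (if i + j ≤ m then piBL (2 * m) i else 0)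
      = if j ≤ m then centralRatio m j else 0 := by
    split_ifs with h
    · rw [← Finset.sum_filter, centralRatio]
      have : {i ∈ Finset.range (m + 1) | i + j ≤ m} = Finset.range (m - j + 1) := by
        ext i
        simp only [Finset.mem_filter, Finset.mem_range]
        omega
      rw [this, sum_range_piBL, hhalf]
    · exact Finset.sum_eq_zero fun i _ => if_neg (by omega)
  rw [PBL, hhalf, ← hsum, ← htail, ← Finset.sum_sub_distrib]
  refine Finset.sum_congr rfl fun i hi => ?_
  have him : i + (m - i) = m := by have := Finset.mem_range.1 hi; omega
  have hiff : WBL (2 * m) i ≤ t ↔ ¬ i + j ≤ m := by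
    rw [WBL_two_mul hm him, div_le_iff₀ hm', mul_comm t, hj]
    omega
  by_cases h : i + j ≤ m
  · simp [hiff, h]
  · simp [hiff, h]

/-- A uniform bound for the distance to the exponential law. -/
lemma abs_PBL_two_mul_sub_le {m : ℕ} (hm : 0 < m) {t : ℝ} (ht : 0 < t) :
    |PBL (2 * m) t - (1 - Real.exp (-t))| ≤ 131 / Real.sqrt m := by
  have hm1 : (1 : ℝ) ≤ m := by exact_mod_cast hm
  have hs : 1 ≤ Real.sqrt m := Real.one_le_sqrt.2 hm1
  have hsm : Real.sqrt m ^ 2 = m := Real.sq_sqrt (by linarith)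
  set s := Real.sqrt m
  have hs0 : 0 < s := by linarith
  have hex : ∃ k : ℕ, (m : ℝ) * t < (k : ℝ) * (k + 1) := by
    obtain ⟨k, hk⟩ := exists_nat_gt ((m : ℝ) * t)
    have hk0 : (0 : ℝ) ≤ k := Nat.cast_nonneg k
    exact ⟨k, by nlinarith⟩
  classical
  obtain ⟨j, hj, hmin⟩ : ∃ j : ℕ, (m : ℝ) * t < (j : ℝ) * (j + 1) ∧
      ∀ k < j, ¬ (m : ℝ) * t < (k : ℝ) * (k + 1) :=
    ⟨Nat.find hex, Nat.find_spec hex, fun k hk => Nat.find_min hex hk⟩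
  have hiff : ∀ k : ℕ, (k : ℝ) * (k + 1) ≤ m * t ↔ k < j := by
    refine fun k => ⟨fun hk => ?_, fun hk => not_lt.1 (hmin k hk)⟩
    by_contra! hjk
    have hjk' : (j : ℝ) ≤ k := by exact_mod_cast hjk
    have : (j : ℝ) * (j + 1) ≤ (k : ℝ) * (k + 1) := by gcongr
    linarith
  rw [PBL_two_mul hm hiff]
  split_ifs with hjm
  · have hjpos : 0 < j := (hiff 0).1 (by simpa using by positivity)
    have hlo : ((j : ℝ) - 1) * j ≤ s ^ 2 * t := by
      have h := (hiff (j - 1)).2 (by omega)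
      rw [Nat.cast_sub (by omega : 1 ≤ j)] at h
      rw [hsm]
      simpa using h
    have h1 := abs_centralRatio_sub_exp_le hs hsm hjm
    have h2 := abs_exp_sq_sub_exp_le hs (Nat.cast_nonneg j)
      (by rw [hsm]; exact_mod_cast hjm) hlo (by rw [hsm]; exact hj.le)
    have h3 : 0 ≤ 1 / (s + j) := by positivity
    have h4 : 131 / s = 128 * (1 / s) + 3 / s := by ring
    have h5 := abs_sub_le (centralRatio m j) (Real.exp (-((j : ℝ) ^ 2 / s ^ 2))) (Real.exp (-t))
    have h6 : 1 - centralRatio m j - (1 - Real.exp (-t))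
        = -(centralRatio m j - Real.exp (-t)) := by ring
    rw [h6, abs_neg]
    linarith
  · have hmt : (m : ℝ) * (m + 1) ≤ m * t := (hiff m).2 (by omega)
    have htm : (m : ℝ) + 1 ≤ t := le_of_mul_le_mul_left hmt (by linarith)
    have hst : s ≤ Real.exp t := by nlinarith [Real.add_one_le_exp t]
    rw [sub_zero, sub_sub_cancel, abs_of_pos (Real.exp_pos _), Real.exp_neg]
    calc (Real.exp t)⁻¹ ≤ s⁻¹ := by gcongr
      _ ≤ 131 / s := by rw [inv_eq_one_div]; gcongr; norm_num

/-- Proposition 4.6 (large): upper bound for large `t`. -/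
theorem bernoulli_laplace_large_t :
    ∃ C : ℝ, ∀ n : ℕ, Even n → 0 < n → ∀ t : ℝ, 0 < t →
      |PBL n t - (1 - Real.exp (-t))| ≤ C * max 1 (1 / t ^ 3) / Real.sqrt n := by
  refine ⟨262, fun n hn hn0 t ht => ?_⟩
  obtain ⟨m, rfl⟩ := hn.two_dvd
  have hm : 0 < m := by omega
  have hm' : (0 : ℝ) < m := by exact_mod_cast hm
  have hsqrt : Real.sqrt ((2 * m : ℕ) : ℝ) ≤ 2 * Real.sqrt m := by
    rw [Real.sqrt_le_left (by positivity), mul_pow, Real.sq_sqrt hm'.le]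
    push_cast
    linarith
  calc |PBL (2 * m) t - (1 - Real.exp (-t))| ≤ 131 / Real.sqrt m := abs_PBL_two_mul_sub_le hm ht
    _ = 262 * 1 / (2 * Real.sqrt m) := by
      have : Real.sqrt (m : ℝ) ≠ 0 := (Real.sqrt_pos.2 hm').ne'
      field_simp
      norm_num
    _ ≤ 262 * max 1 (1 / t ^ 3) / Real.sqrt ((2 * m : ℕ) : ℝ) := by
      have : 0 < Real.sqrt ((2 * m : ℕ) : ℝ) := Real.sqrt_pos.2 (by exact_mod_cast hn0)
      gcongr
      exact le_max_left _ _
end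

section
/- Let n be even, let W(i) := (n − 2i)(n + 2 − 2i)/(2n) for i ∈ {0,1,…,n/2}, let π(i) = (C(n,i) − C(n,i−1))/C(n, n/2) for 1 ≤ i ≤ n/2 and π(0) = 1/C(n, n/2), and let K be the birth-death transition matrix on {0,1,…,n/2} whose only non-zero off-diagonal entries are K(i,i+1) := (n−i+1)(n−2i)/(n(n−2i+1)) and K(i,i−1) := i(n−2i+2)/(n(n−2i+1)). For each i and each positive integer m write M_m(i) := Σ_j K(i,j)·(W(j) − W(i))^m. Then: (1) M₁(i) = −(4/n)·(W(i) − 1) for all i; (2) Σ_i π(i)·W(i) = 1; (3) M₂(i) = (8/n)·W(i) − (16/n²)·(W(i) − 1) for all i; (4) Σ_i π(i)·(W(i) − 1)² = 1 (that is, W has variance 1); (5) M₄(i) = (32/n²)·( 2W(i)² + (12W(i) − 8W(i)²)/n + 8(1 − W(i))/n² ) for all i; (6) M₄(i) ≤ (256/n²)·W(i)² + (256/n⁴)·1[W(i) = 0] for all i. -/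
open Finset

/-- The birth-death transition matrix of Subsection 4.2, whose only non-zero entries are
`K(i,i+1) = (n-i+1)(n-2i)/(n(n-2i+1))` and `K(i,i-1) = i(n-2i+2)/(n(n-2i+1))`. -/
noncomputable def KBL2 (n i j : ℕ) : ℝ :=
  if j = i + 1 then ((n : ℝ) - i + 1) * ((n : ℝ) - 2 * i) / ((n : ℝ) * ((n : ℝ) - 2 * i + 1))
  else if i = j + 1 then (i : ℝ) * ((n : ℝ) - 2 * i + 2) / ((n : ℝ) * ((n : ℝ) - 2 * i + 1))
  else 0

/-- `M_m(i) = Σ_j K(i,j) (W(j) - W(i))^m`, the `m`-th conditional moment of the increment. -/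
noncomputable def MBL2 (n m i : ℕ) : ℝ :=
  ∑ j ∈ Finset.range (n / 2 + 1), KBL2 n i j * (WBL n j - WBL n i) ^ m

theorem WBL_succ_sub {n : ℕ} (hn : 0 < n) (i : ℕ) :
    WBL n (i + 1) - WBL n i = -(2 * ((n : ℝ) - 2 * i) / n) := by
  have : (n : ℝ) ≠ 0 := by positivity
  unfold WBL
  push_cast
  field_simp
  ring

theorem WBL_half {n : ℕ} (hn : Even n) : WBL n (n / 2) = 0 := by
  obtain ⟨k, rfl⟩ := hn
  have : (k + k) / 2 = k := by omega
  rw [this]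
  unfold WBL
  push_cast
  ring

/-- The increment moments as an explicit two-term sum; boundary terms vanish with the
corresponding transition probability. -/
theorem MBL2_eq {n m i : ℕ} (hn : Even n) (hpos : 0 < n) (hi : i ≤ n / 2) :
    MBL2 n m i =
      ((n : ℝ) - i + 1) * ((n : ℝ) - 2 * i) / ((n : ℝ) * ((n : ℝ) - 2 * i + 1)) *
        (-(2 * ((n : ℝ) - 2 * i) / n)) ^ m +
      (i : ℝ) * ((n : ℝ) - 2 * i + 2) / ((n : ℝ) * ((n : ℝ) - 2 * i + 1)) *
        (2 * ((n : ℝ) - 2 * i + 2) / n) ^ m := by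
  have hK : ∀ j, KBL2 n i j * (WBL n j - WBL n i) ^ m =
      (if j = i + 1 then ((n : ℝ) - i + 1) * ((n : ℝ) - 2 * i) /
        ((n : ℝ) * ((n : ℝ) - 2 * i + 1)) * (WBL n j - WBL n i) ^ m else 0) +
      (if i = j + 1 then (i : ℝ) * ((n : ℝ) - 2 * i + 2) /
        ((n : ℝ) * ((n : ℝ) - 2 * i + 1)) * (WBL n j - WBL n i) ^ m else 0) := by
    intro j
    unfold KBL2
    split_ifs <;> first | omega | simp
  unfold MBL2
  rw [Finset.sum_congr rfl fun j _ => hK j, Finset.sum_add_distrib]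
  congr 1
  · rw [Finset.sum_ite_eq', WBL_succ_sub hpos]
    split_ifs with h
    · rfl
    · have hik : n = 2 * i := by
        obtain ⟨k, rfl⟩ := hn
        simp only [Finset.mem_range] at h
        omega
      have : (n : ℝ) - 2 * i = 0 := by rw [hik]; push_cast; ring
      rw [this]
      simp
  · rcases i with _ | s
    · simp
    · have hs : ∀ j, (s + 1 = j + 1) = (j = s) := fun j => by
        rw [eq_iff_iff]
        omega
      simp only [hs]
      rw [Finset.sum_ite_eq', if_pos (Finset.mem_range.2 (by omega)), ← neg_sub (WBL n (s + 1)),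
        WBL_succ_sub hpos]
      congr 2
      push_cast
      ring

theorem piBL_succ (n i : ℕ) :
    piBL n (i + 1) = ((n.choose (i + 1) : ℝ) - n.choose i) / n.choose (n / 2) := by
  simp [piBL]

theorem choose_succ_mul_cast {n m : ℕ} (h : m ≤ n) :
    (n.choose (m + 1) : ℝ) * (m + 1) = n.choose m * ((n : ℝ) - m) := by
  rw [← Nat.cast_sub h]
  exact_mod_cast Nat.choose_succ_right_eq n m

theorem sum_piBL_mul_WBL {n : ℕ} (hpos : 0 < n) (m : ℕ) (hm : m ≤ n) :
    ∑ i ∈ Finset.range (m + 1), piBL n i * WBL n i =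
      n.choose m / n.choose (n / 2) * (WBL n m + 2 * m / n) := by
  induction m with
  | zero => simp [piBL]
  | succ m ih =>
    have h := choose_succ_mul_cast (n := n) (m := m) (by omega)
    have hW := WBL_succ_sub hpos m
    rw [Finset.sum_range_succ, ih (by omega), piBL_succ]
    push_cast
    linear_combination (-(2 / (n : ℝ)) / n.choose (n / 2)) * h -
      (n.choose m / n.choose (n / 2) : ℝ) * hW

theorem sum_piBL_mul_WBL_sub_one_sq {n : ℕ} (hpos : 0 < n) (m : ℕ) (hm : m ≤ n) :
    ∑ i ∈ Finset.range (m + 1), piBL n i * (WBL n i - 1) ^ 2 =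
      n.choose m / n.choose (n / 2) * ((WBL n m - 1) ^ 2 + 4 * m * WBL n m / n) := by
  induction m with
  | zero => simp [piBL]
  | succ m ih =>
    have h := choose_succ_mul_cast (n := n) (m := m) (by omega)
    have hW : (WBL n m - 1) ^ 2 + 4 * m * WBL n m / n - (WBL n (m + 1) - 1) ^ 2 =
        4 * ((n : ℝ) - m) * WBL n (m + 1) / n := by
      have : (n : ℝ) ≠ 0 := by positivity
      unfold WBL
      push_cast
      field_simp
      ring
    rw [Finset.sum_range_succ, ih (by omega), piBL_succ]
    push_cast
    linear_combination (-(4 * WBL n (m + 1) / (n : ℝ)) / n.choose (n / 2)) * h +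
      (n.choose m / n.choose (n / 2) : ℝ) * hW

theorem MBL2_four {n i : ℕ} (hn : Even n) (hpos : 0 < n) (hi : i ≤ n / 2) :
    MBL2 n 4 i = (32 / (n : ℝ) ^ 2) *
      (2 * WBL n i ^ 2 + (12 * WBL n i - 8 * WBL n i ^ 2) / n +
        8 * (1 - WBL n i) / (n : ℝ) ^ 2) := by
  have h0 : (n : ℝ) ≠ 0 := by positivity
  have h2 : (2 * i : ℝ) ≤ n := by exact_mod_cast (by omega : 2 * i ≤ n)
  have h1 : (n : ℝ) - 2 * i + 1 ≠ 0 := by linarith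
  rw [MBL2_eq hn hpos hi]
  unfold WBL
  obtain ⟨e, he⟩ : ∃ e, e = (n : ℝ) - 2 * i + 1 := ⟨_, rfl⟩
  rw [← he] at h1 ⊢
  field_simp
  rw [he]
  ring

theorem four_div_le_WBL {n i : ℕ} (hpos : 0 < n) (hi : i < n / 2) :
    4 / (n : ℝ) ≤ WBL n i := by
  have h2 : (2 * i + 2 : ℝ) ≤ n := by
    exact_mod_cast (by omega : 2 * i + 2 ≤ n)
  have h0 : (0 : ℝ) < n := by positivity
  unfold WBL
  rw [div_le_div_iff₀ h0 (by positivity)]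
  nlinarith [mul_nonneg (sub_nonneg.2 h2) (sub_nonneg.2 h2)]

theorem MBL2_four_le {n i : ℕ} (hn : Even n) (hpos : 0 < n) (hi : i ≤ n / 2) :
    MBL2 n 4 i ≤ (256 / (n : ℝ) ^ 2) * WBL n i ^ 2 +
      (256 / (n : ℝ) ^ 4) * (if WBL n i = 0 then 1 else 0) := by
  have h0 : (0 : ℝ) < n := by positivity
  rw [MBL2_four hn hpos hi]
  rcases hi.eq_or_lt with rfl | hi
  · rw [WBL_half hn, if_pos rfl]
    apply le_of_eq
    field_simp
    ring
  · have hW := four_div_le_WBL hpos hi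
    have h4 : 0 < 4 / (n : ℝ) := by positivity
    rw [if_neg (by linarith)]
    have key : 2 * WBL n i ^ 2 + (12 * WBL n i - 8 * WBL n i ^ 2) / n +
        8 * (1 - WBL n i) / (n : ℝ) ^ 2 ≤ 8 * WBL n i ^ 2 := by
      set w := WBL n i
      have hw : 0 < w := h4.trans_le hW
      have hu : 4 * (n : ℝ)⁻¹ ≤ w := by simpa [div_eq_mul_inv] using hW
      have hu0 : 0 < (n : ℝ)⁻¹ := by positivity
      have e : 2 * w ^ 2 + (12 * w - 8 * w ^ 2) / n + 8 * (1 - w) / (n : ℝ) ^ 2 =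
          2 * w ^ 2 + (12 * w - 8 * w ^ 2) * (n : ℝ)⁻¹ + 8 * (1 - w) * (n : ℝ)⁻¹ ^ 2 := by
        field_simp
      rw [e]
      have a1 : 4 * (n : ℝ)⁻¹ * w ≤ w * w := by gcongr
      have a2 : (4 * (n : ℝ)⁻¹) ^ 2 ≤ w ^ 2 := by gcongr
      have a3 : 0 < w ^ 2 * (n : ℝ)⁻¹ := by positivity
      have a4 : 0 < w * (n : ℝ)⁻¹ ^ 2 := by positivity
      nlinarith
    calc _ ≤ 32 / (n : ℝ) ^ 2 * (8 * WBL n i ^ 2) := by gcongr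
      _ = _ := by ring

/-- Lemma 4.8 (momcom2): moment computations for the exchangeable pair of Subsection 4.2. -/
theorem moment_computations_v2 (n : ℕ) (hn : Even n) (hpos : 0 < n) :
    (∀ i ≤ n / 2, MBL2 n 1 i = -(4 / (n : ℝ)) * (WBL n i - 1)) ∧
    (∑ i ∈ Finset.range (n / 2 + 1), piBL n i * WBL n i = 1) ∧
    (∀ i ≤ n / 2, MBL2 n 2 i = (8 / (n : ℝ)) * WBL n i - (16 / (n : ℝ) ^ 2) * (WBL n i - 1)) ∧
    (∑ i ∈ Finset.range (n / 2 + 1), piBL n i * (WBL n i - 1) ^ 2 = 1) ∧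
    (∀ i ≤ n / 2, MBL2 n 4 i = (32 / (n : ℝ) ^ 2) *
      (2 * WBL n i ^ 2 + (12 * WBL n i - 8 * WBL n i ^ 2) / n + 8 * (1 - WBL n i) / (n : ℝ) ^ 2)) ∧
    (∀ i ≤ n / 2, MBL2 n 4 i ≤ (256 / (n : ℝ) ^ 2) * WBL n i ^ 2 +
      (256 / (n : ℝ) ^ 4) * (if WBL n i = 0 then 1 else 0)) := by
  have h0 : (n : ℝ) ≠ 0 := by positivity
  have hc : (n.choose (n / 2) : ℝ) ≠ 0 := by
    exact_mod_cast (Nat.choose_pos (Nat.div_le_self n 2)).ne'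
  have hhalf : 2 * ((n / 2 : ℕ) : ℝ) = n := by exact_mod_cast Nat.two_mul_div_two_of_even hn
  have hd : ∀ i ≤ n / 2, (n : ℝ) - 2 * i + 1 ≠ 0 := fun i hi => by
    have : (2 * i : ℝ) ≤ n := by exact_mod_cast (by omega : 2 * i ≤ n)
    linarith
  refine ⟨fun i hi => ?_, ?_, fun i hi => ?_, ?_, fun i hi => MBL2_four hn hpos hi,
    fun i hi => MBL2_four_le hn hpos hi⟩
  · have h1 := hd i hi
    rw [MBL2_eq hn hpos hi]
    unfold WBL
    obtain ⟨e, he⟩ : ∃ e, e = (n : ℝ) - 2 * i + 1 := ⟨_, rfl⟩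
    rw [← he] at h1 ⊢
    field_simp
    rw [he]
    ring
  · rw [sum_piBL_mul_WBL hpos _ (Nat.div_le_self n 2), WBL_half hn, hhalf, div_self hc,
      div_self h0]
    norm_num
  · have h1 := hd i hi
    rw [MBL2_eq hn hpos hi]
    unfold WBL
    obtain ⟨e, he⟩ : ∃ e, e = (n : ℝ) - 2 * i + 1 := ⟨_, rfl⟩
    rw [← he] at h1 ⊢
    field_simp
    rw [he]
    ring
  · rw [sum_piBL_mul_WBL_sub_one_sq hpos _ (Nat.div_le_self n 2), WBL_half hn, div_self hc]
    norm_num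
end
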